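/- Let X = projlim X_n p_n be a reduced regular projective limit of real vector lattices and let a : X → ℝ be an increasing affine function. Then there exists n₀ ∈ ℕ such that for every n ≥ n₀ there is a positive linear functional l_n : X_n → ℝ with a(x) = l_n(pr_n x) + a(0) for all x ∈ X; if a is moreover positive (a(x) ≥ 0 for all x ≥ 0) then also a(0) ≥ 0. Conversely, for any positive linear l_n : X_n → ℝ and any a₀ ∈ ℝ, the function x ↦ l_n(pr_n x) + a₀ is increasing affine on X, and it is positive if a₀ ≥ 0. -/

import Mathlib

/-
A sequence `(X n)` of real vector lattices with positive linear maps
`p n : X (n+1) →ₗ[ℝ] X n` is given.  The projective limit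
`projlim Xₙ pₙ` is realized as the submodule of the product `∀ n, X n`
consisting of all `x` with `x n = p n (x (n+1))` for all `n`, ordered
componentwise (the subtype order induced from the product order).
-/

variable {X : ℕ → Type*} [∀ n, Lattice (X n)] [∀ n, AddCommGroup (X n)]
  [∀ n, Module ℝ (X n)]
  [∀ n, CovariantClass (X n) (X n) (· + ·) (· ≤ ·)]
  [∀ n, PosSMulMono ℝ (X n)]

/-- The projective limit of the inverse system `p`, as a submodule of the product
`∀ n, X n` (with the componentwise partial order). -/
def ProjLim (p : ∀ n, X (n + 1) →ₗ[ℝ] X n) : Submodule ℝ (∀ n, X n) where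
  carrier := {x | ∀ n, x n = p n (x (n + 1))}
  add_mem' := by
    intro x y hx hy n
    show x n + y n = p n (x (n + 1) + y (n + 1))
    rw [map_add, ← hx n, ← hy n]
  zero_mem' := by
    intro n
    show (0 : X n) = p n 0
    rw [map_zero]
  smul_mem' := by
    intro c x hx n
    show c • x n = p n (c • x (n + 1))
    rw [map_smul, ← hx n]

/-- A real function on a real vector space that respects proper convex combinations and vanishes
at the origin is linear. -/
theorem exists_linearMap_of_affine {E : Type*} [AddCommGroup E] [Module ℝ E] (a : E → ℝ)
    (ha : ∀ t : ℝ, 0 < t → t < 1 → ∀ x y : E,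
      a (t • x + (1 - t) • y) = t * a x + (1 - t) * a y) :
    ∃ f : E →ₗ[ℝ] ℝ, ∀ x, a x = f x + a 0 := by
  have hlt : ∀ t : ℝ, 0 < t → t < 1 → ∀ x, a (t • x) - a 0 = t * (a x - a 0) := by
    intro t h0 h1 x
    have h := ha t h0 h1 x 0
    rw [smul_zero, add_zero] at h
    rw [h]
    ring
  have hpos : ∀ t : ℝ, 0 < t → ∀ x, a (t • x) - a 0 = t * (a x - a 0) := by
    intro t h0 x
    rcases lt_trichotomy t 1 with h1 | rfl | h1
    · exact hlt t h0 h1 x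
    · simp
    · have h := hlt t⁻¹ (inv_pos.2 h0) (inv_lt_one_of_one_lt₀ h1) (t • x)
      rw [inv_smul_smul₀ h0.ne'] at h
      rw [h, mul_inv_cancel_left₀ h0.ne']
  have hadd : ∀ x y, a (x + y) - a 0 = (a x - a 0) + (a y - a 0) := by
    intro x y
    have h := ha (1 / 2) (by norm_num) (by norm_num) x y
    rw [show (1 - 1 / 2 : ℝ) = 1 / 2 by norm_num, ← smul_add] at h
    have h2 := hlt (1 / 2) (by norm_num) (by norm_num) (x + y)
    linarith
  have hneg : ∀ x, a (-x) - a 0 = -(a x - a 0) := by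
    intro x
    have h := hadd x (-x)
    rw [add_neg_cancel] at h
    linarith
  refine ⟨⟨⟨fun x => a x - a 0, hadd⟩, fun t x => ?_⟩, fun x => (sub_add_cancel _ _).symm⟩
  change a (t • x) - a 0 = t * (a x - a 0)
  rcases lt_trichotomy t 0 with h | rfl | h
  · have h1 := hpos (-t) (neg_pos.2 h) x
    rw [neg_smul, hneg] at h1
    linarith
  · simp
  · exact hpos t h x

set_option linter.unusedSectionVars false in
/-- The projective limit of a regular system is closed under absolute values. -/
theorem ProjLim.abs_mem {p : ∀ n, X (n + 1) →ₗ[ℝ] X n}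
    (hreg : ∀ n, ∀ a b : X (n + 1), p n (a ⊔ b) = p n a ⊔ p n b)
    {x : ∀ m, X m} (hx : x ∈ ProjLim p) : (fun m => |x m|) ∈ ProjLim p := by
  intro n
  change x n ⊔ -x n = p n (x (n + 1) ⊔ -x (n + 1))
  rw [hreg, map_neg, ← hx n]

set_option linter.unusedSectionVars false in
/-- If a coordinate of an element of the projective limit vanishes, so do all earlier ones. -/
theorem ProjLim.apply_eq_zero_of_le {p : ∀ n, X (n + 1) →ₗ[ℝ] X n}
    {x : ∀ m, X m} (hx : x ∈ ProjLim p) {m n : ℕ} (hmn : m ≤ n) (h : x n = 0) : x m = 0 := by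
  induction n, hmn using Nat.le_induction with
  | base => exact h
  | succ k _ ih => exact ih (by rw [hx k, h, map_zero])

/-- A sequence of nonnegative elements of the projective limit whose `n`-th term vanishes at the
`n`-th coordinate has an upper bound for all of its partial sums. -/
theorem ProjLim.exists_sum_range_le {p : ∀ n, X (n + 1) →ₗ[ℝ] X n}
    (y : ℕ → ↥(ProjLim p)) (hy : ∀ n, 0 ≤ y n) (hy0 : ∀ n, (y n : ∀ m, X m) n = 0) :
    ∃ z : ↥(ProjLim p), ∀ N, ∑ k ∈ Finset.range N, y k ≤ z := by
  have hsum : ∀ m M, m ≤ M → ∑ k ∈ Finset.range m, (y k : ∀ m, X m) m =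
      ∑ k ∈ Finset.range M, (y k : ∀ m, X m) m := by
    intro m M hM
    refine Finset.sum_subset (Finset.range_mono hM) fun k _ hk => ?_
    exact apply_eq_zero_of_le (y k).2 (by simpa using hk) (hy0 k)
  refine ⟨⟨fun m => ∑ k ∈ Finset.range m, (y k : ∀ m, X m) m, fun n => ?_⟩, fun N m => ?_⟩
  · change ∑ k ∈ Finset.range n, (y k : ∀ m, X m) n =
      p n (∑ k ∈ Finset.range (n + 1), (y k : ∀ m, X m) (n + 1))
    rw [map_sum, hsum n (n + 1) n.le_succ]
    exact Finset.sum_congr rfl fun k _ => (y k).2 n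
  · have : IsOrderedAddMonoid (X m) := ⟨fun a b h c => by gcongr, fun a b h c => by gcongr⟩
    change (((∑ k ∈ Finset.range N, y k : ↥(ProjLim p))) : ∀ m, X m) m ≤
      ∑ k ∈ Finset.range m, (y k : ∀ m, X m) m
    rw [hsum m (max N m) (le_max_right _ _), Submodule.coe_sum, Finset.sum_apply]
    exact Finset.sum_le_sum_of_subset_of_nonneg (Finset.range_mono (le_max_left _ _))
      fun k _ _ => hy k m

/-- A positive linear functional on a regular projective limit vanishes on the kernel of some
coordinate projection. -/
theorem ProjLim.exists_forall_apply_eq_zero {p : ∀ n, X (n + 1) →ₗ[ℝ] X n}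
    (hreg : ∀ n, ∀ a b : X (n + 1), p n (a ⊔ b) = p n a ⊔ p n b)
    (f : ↥(ProjLim p) →ₗ[ℝ] ℝ) (hf : Monotone f) :
    ∃ n, ∀ x : ↥(ProjLim p), (x : ∀ m, X m) n = 0 → f x = 0 := by
  by_contra! hcon
  have key : ∀ n, ∃ y : ↥(ProjLim p), 0 ≤ y ∧ (y : ∀ m, X m) n = 0 ∧ 1 ≤ f y := by
    intro n
    obtain ⟨x, hx, hfx⟩ := hcon n
    let w : ↥(ProjLim p) := ⟨fun m => |(x : ∀ m, X m) m|, abs_mem hreg x.2⟩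
    have hw : 0 ≤ w := fun m => abs_nonneg ((x : ∀ m, X m) m)
    have h1 : f x ≤ f w := hf fun m => le_abs_self ((x : ∀ m, X m) m)
    have h2 : f (-x) ≤ f w := hf fun m => neg_le_abs ((x : ∀ m, X m) m)
    have hfw : 0 < f w := by
      rw [map_neg] at h2
      exact (abs_pos.2 hfx).trans_le (abs_le'.2 ⟨h1, h2⟩)
    refine ⟨(f w)⁻¹ • w, fun m => smul_nonneg (inv_nonneg.2 hfw.le) (hw m), ?_, ?_⟩
    · change (f w)⁻¹ • |(x : ∀ m, X m) n| = 0
      rw [hx, abs_zero, smul_zero]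
    · rw [map_smul, smul_eq_mul, inv_mul_cancel₀ hfw.ne']
  choose y hy hy0 hfy using key
  obtain ⟨z, hz⟩ := exists_sum_range_le y hy hy0
  obtain ⟨N, hN⟩ := exists_nat_gt (f z)
  have h1 : f (∑ k ∈ Finset.range N, y k) ≤ f z := hf (hz N)
  have h2 : (N : ℝ) ≤ f (∑ k ∈ Finset.range N, y k) := by
    rw [map_sum]
    simpa using Finset.card_nsmul_le_sum (Finset.range N) (fun k => f (y k)) 1 fun k _ => hfy k
  linarith

/-- A linear map vanishing on the kernel of a surjective linear map factors through it. -/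
theorem LinearMap.exists_comp_eq_of_surjective {E F : Type*} [AddCommGroup E] [Module ℝ E]
    [AddCommGroup F] [Module ℝ F] (π : E →ₗ[ℝ] F) (hπ : Function.Surjective π)
    (f : E →ₗ[ℝ] ℝ) (hf : ∀ x, π x = 0 → f x = 0) : ∃ l : F →ₗ[ℝ] ℝ, ∀ x, l (π x) = f x := by
  obtain ⟨s, hs⟩ := π.exists_rightInverse_of_surjective (LinearMap.range_eq_top.2 hπ)
  refine ⟨f ∘ₗ s, fun x => ?_⟩
  have h : π (s (π x)) = π x := LinearMap.congr_fun hs (π x)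
  exact sub_eq_zero.1 ((map_sub f _ _).symm.trans (hf _ (by rw [map_sub, h, sub_self])))

/-
STATEMENT 5.  On a reduced regular projective limit `X = projlim Xₙ pₙ`
of real vector lattices, every increasing affine `a : X → ℝ` has, for all
sufficiently large `n`, the form `a x = lₙ (prₙ x) + a 0` with
`lₙ : Xₙ → ℝ` positive linear; if `a` is positive then also `a 0 ≥ 0`.
Conversely `x ↦ lₙ (prₙ x) + a₀` is increasing affine for every positive
linear `lₙ` and `a₀ ∈ ℝ`, and positive whenever `a₀ ≥ 0`.
-/
theorem increasing_affine_factors_through_projection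
    (p : ∀ n, X (n + 1) →ₗ[ℝ] X n)
    (hpos : ∀ n, ∀ a : X (n + 1), 0 ≤ a → 0 ≤ p n a)
    (hreg : ∀ n, ∀ a b : X (n + 1), p n (a ⊔ b) = p n a ⊔ p n b)
    (hred : ∀ n, ∀ y : X n, ∃ x : ∀ m, X m, x ∈ ProjLim p ∧ x n = y) :
    (∀ a : ↥(ProjLim p) → ℝ,
      (∀ t : ℝ, 0 < t → t < 1 → ∀ x y : ↥(ProjLim p),
        a (t • x + (1 - t) • y) = t * a x + (1 - t) * a y) →
      Monotone a →
      (∃ n₀ : ℕ, ∀ n, n₀ ≤ n → ∃ lₙ : X n →ₗ[ℝ] ℝ,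
        (∀ u : X n, 0 ≤ u → 0 ≤ lₙ u) ∧
        (∀ x : ↥(ProjLim p), a x = lₙ ((x : ∀ m, X m) n) + a 0)) ∧
      ((∀ x : ↥(ProjLim p), 0 ≤ x → 0 ≤ a x) → 0 ≤ a 0)) ∧
    (∀ n : ℕ, ∀ lₙ : X n →ₗ[ℝ] ℝ,
      (∀ u : X n, 0 ≤ u → 0 ≤ lₙ u) → ∀ a₀ : ℝ,
      (∀ t : ℝ, 0 < t → t < 1 → ∀ x y : ↥(ProjLim p),
        lₙ (((t • x + (1 - t) • y : ↥(ProjLim p)) : ∀ m, X m) n) + a₀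
          = t * (lₙ ((x : ∀ m, X m) n) + a₀)
            + (1 - t) * (lₙ ((y : ∀ m, X m) n) + a₀)) ∧
      Monotone (fun x : ↥(ProjLim p) => lₙ ((x : ∀ m, X m) n) + a₀) ∧
      (0 ≤ a₀ → ∀ x : ↥(ProjLim p), 0 ≤ x →
        0 ≤ lₙ ((x : ∀ m, X m) n) + a₀)) := by
  refine ⟨fun a ha hmono => ⟨?_, fun h => h 0 le_rfl⟩, fun n l hl a₀ => ⟨?_, ?_, ?_⟩⟩
  · obtain ⟨f, hf⟩ := exists_linearMap_of_affine a ha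
    have hfmono : Monotone f := fun x y hxy => by
      have h := hmono hxy
      rw [hf x, hf y] at h
      exact le_of_add_le_add_right h
    obtain ⟨n₀, hn₀⟩ := ProjLim.exists_forall_apply_eq_zero hreg f hfmono
    refine ⟨n₀, fun n hn => ?_⟩
    obtain ⟨l, hl⟩ := LinearMap.exists_comp_eq_of_surjective
      (LinearMap.proj n ∘ₗ (ProjLim p).subtype)
      (fun y => (hred n y).elim fun x hx => ⟨⟨x, hx.1⟩, hx.2⟩) f
      (fun x hx => hn₀ x (ProjLim.apply_eq_zero_of_le x.2 hn hx))
    have hl' : ∀ x : ↥(ProjLim p), l ((x : ∀ m, X m) n) = f x := hl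
    refine ⟨l, fun u hu => ?_, fun x => by rw [hl', hf x]⟩
    obtain ⟨x, hx, rfl⟩ := hred n u
    have h := hl' ⟨_, ProjLim.abs_mem hreg hx⟩
    change l |x n| = _ at h
    rw [abs_of_nonneg hu] at h
    rw [h, ← map_zero f]
    exact hfmono fun m => abs_nonneg (x m)
  · intro t _ _ x y
    change l (t • (x : ∀ m, X m) n + (1 - t) • (y : ∀ m, X m) n) + a₀ = _
    rw [map_add, map_smul, map_smul, smul_eq_mul, smul_eq_mul]
    ring
  · intro x y hxy
    have h := hl _ (sub_nonneg.2 (hxy n))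
    rw [map_sub] at h
    exact add_le_add_left (sub_nonneg.1 h) a₀
  · intro h x hx
    exact add_nonneg (hl _ (hx n)) h
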